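/- arXiv:2605.13143 — 5 statements merged into one kernel-verified Lean document; each statement's English description precedes it below -/
import Mathlib

section
/- Let Z be a measurable space, P a probability measure on Z, F a set, ℓ: F × Z → ℝ a loss taking values in [a, b], and A: Z^n → F a learning algorithm that is β-uniformly stable. Define the generalization gap H(d) = E_{z∼P}[ℓ(A(d), z)] − (1/n)∑_{i=1}^n ℓ(A(d), d_i). Then for any two datasets d, d' ∈ Z^n differing in exactly one coordinate, |H(d) − H(d')| ≤ 2β + (b − a)/n. -/
open MeasureTheory

/-- Two datasets differ in exactly one coordinate. -/
def DifferOne {Z : Type*} {n : ℕ} (d d' : Fin n → Z) : Prop :=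
  ∃ i : Fin n, d i ≠ d' i ∧ ∀ j : Fin n, j ≠ i → d j = d' j

/-- bounded differences for the generalization gap of a
`β`-uniformly stable algorithm with loss in `[a, b]`. -/
theorem stmt_1 {Z F : Type*} [MeasurableSpace Z] (P : Measure Z) [IsProbabilityMeasure P]
    (n : ℕ) (hn : 0 < n) (ℓ : F → Z → ℝ) (a b : ℝ)
    (hmeas : ∀ f : F, Measurable (ℓ f))
    (hbdd : ∀ (f : F) (z : Z), ℓ f z ∈ Set.Icc a b)
    (A : (Fin n → Z) → F) (β : ℝ)
    (hstable : ∀ d d' : Fin n → Z, DifferOne d d' →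
      ∀ z : Z, |ℓ (A d) z - ℓ (A d') z| ≤ β)
    (H : (Fin n → Z) → ℝ)
    (hH : ∀ d : Fin n → Z,
      H d = (∫ z, ℓ (A d) z ∂P) - (1 / (n : ℝ)) * ∑ i : Fin n, ℓ (A d) (d i)) :
    ∀ d d' : Fin n → Z, DifferOne d d' → |H d - H d'| ≤ 2 * β + (b - a) / n := by
  intro d d' hd
  have hint (f : F) : Integrable (ℓ f) P :=
    .of_mem_Icc a b (hmeas f).aemeasurable (.of_forall (hbdd f))
  have hrisk : |(∫ z, ℓ (A d) z ∂P) - ∫ z, ℓ (A d') z ∂P| ≤ β := by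
    rw [← integral_sub (hint _) (hint _)]
    simpa using norm_integral_le_of_norm_le_const (μ := P)
      (f := fun z => ℓ (A d) z - ℓ (A d') z) (.of_forall (hstable d d' hd))
  have hn' : (0 : ℝ) < n := by exact_mod_cast hn
  have hsum : |∑ j, ℓ (A d) (d j) - ∑ j, ℓ (A d') (d' j)| ≤ n * β + (b - a) := by
    have ⟨i, _, hi⟩ := hd
    rw [← Finset.sum_sub_distrib]
    calc |∑ j, (ℓ (A d) (d j) - ℓ (A d') (d' j))|
        ≤ ∑ j, |ℓ (A d) (d j) - ℓ (A d') (d' j)| := Finset.abs_sum_le_sum_abs _ _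
      _ ≤ ∑ j, (β + if j = i then b - a else 0) := by
          refine Finset.sum_le_sum fun j _ => ?_
          have hst := hstable d d' hd (d j)
          split_ifs with hj
          · have hβ : 0 ≤ β := (abs_nonneg _).trans hst
            have h₁ := hbdd (A d) (d j)
            have h₂ := hbdd (A d') (d' j)
            rw [abs_le]
            constructor <;> linarith [h₁.1, h₁.2, h₂.1, h₂.2]
          · rw [← hi j hj]
            simpa using hst
      _ = n * β + (b - a) := by simp [Finset.sum_add_distrib]
  have hemp : |1 / (n : ℝ) * ∑ j, ℓ (A d) (d j) - 1 / (n : ℝ) * ∑ j, ℓ (A d') (d' j)|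
      ≤ β + (b - a) / n := by
    rw [← mul_sub, abs_mul, abs_of_pos (by positivity)]
    calc 1 / (n : ℝ) * |∑ j, ℓ (A d) (d j) - ∑ j, ℓ (A d') (d' j)|
        ≤ 1 / (n : ℝ) * (n * β + (b - a)) := by gcongr
      _ = β + (b - a) / n := by field_simp
  rw [hH d, hH d', sub_sub_sub_comm]
  linarith [abs_sub
    ((∫ z, ℓ (A d) z ∂P) - ∫ z, ℓ (A d') z ∂P)
    (1 / (n : ℝ) * ∑ j, ℓ (A d) (d j) - 1 / (n : ℝ) * ∑ j, ℓ (A d') (d' j))]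
end

section
/- Let Z be a measurable space, P a probability measure on Z, ℓ: F × Z → ℝ a loss taking values in [a, b], and A: Z^n → F a β-uniformly stable learning algorithm such that the generalization gap H: Z^n → ℝ is measurable. If D_n = (Z_1, …, Z_n) consists of n i.i.d. samples from P, then H(D_n) is σ²-sub-Gaussian under P^{⊗n} with variance proxy σ² = (n/4)·(2β + (b − a)/n)². -/
open MeasureTheory Real

/-- `h` is `σ²`-sub-Gaussian under `P`:
`E_P[exp (λ (h − E_P h))] ≤ exp (λ² σ² / 2)` for all `λ : ℝ`. -/
def SubGaussian {Ω : Type*} [MeasurableSpace Ω] (P : Measure Ω) (h : Ω → ℝ) (σ2 : ℝ) : Prop :=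
  ∀ l : ℝ, ∫ x, Real.exp (l * (h x - ∫ y, h y ∂P)) ∂P ≤ Real.exp (l ^ 2 * σ2 / 2)

open ProbabilityTheory

/-- Hoeffding's lemma for a function whose oscillation is at most `c`. -/
lemma subGaussian_of_oscillation_le {Z : Type*} [MeasurableSpace Z] (P : Measure Z)
    [IsProbabilityMeasure P] {G : Z → ℝ} (hG : Measurable G) {c : ℝ}
    (hc : ∀ z z', |G z - G z'| ≤ c) : SubGaussian P G (c ^ 2 / 4) := by
  intro l
  have hne : Nonempty Z := nonempty_of_isProbabilityMeasure P
  have hbdd : BddBelow (Set.range G) := by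
    obtain ⟨z₀⟩ := hne
    refine ⟨G z₀ - c, ?_⟩
    rintro _ ⟨z, rfl⟩
    linarith [(abs_le.1 (hc z₀ z)).2]
  have hmem : ∀ z, G z ∈ Set.Icc (⨅ z, G z) ((⨅ z, G z) + c) := fun z ↦ by
    refine ⟨ciInf_le hbdd z, ?_⟩
    have : G z - c ≤ ⨅ z, G z := le_ciInf fun z' ↦ by linarith [(abs_le.1 (hc z z')).2]
    linarith
  have h := (hasSubgaussianMGF_of_mem_Icc hG.aemeasurable (ae_of_all P hmem)).mgf_le l
  refine h.trans_eq ?_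
  congr 1
  simp only [add_sub_cancel_left, NNReal.coe_pow, NNReal.coe_div, coe_nnnorm, norm_eq_abs,
    NNReal.coe_ofNat, div_pow, sq_abs]
  ring

/-- McDiarmid's inequality in moment generating function form: a bounded function of independent
variables with bounded differences `c i` is sub-Gaussian with variance proxy `(∑ i, c i ^ 2) / 4`. -/
lemma subGaussian_pi_of_boundedDifferences {Z : Type*} [MeasurableSpace Z] (P : Measure Z)
    [IsProbabilityMeasure P] {n : ℕ} {H : (Fin n → Z) → ℝ} (hH : Measurable H) {M : ℝ}
    (hM : ∀ d, |H d| ≤ M) {c : Fin n → ℝ}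
    (hc : ∀ (i : Fin n) (d d' : Fin n → Z), (∀ j, j ≠ i → d j = d' j) → |H d - H d'| ≤ c i) :
    SubGaussian (Measure.pi fun _ : Fin n => P) H ((∑ i, c i ^ 2) / 4) := by
  induction n with
  | zero =>
    intro l
    have h : ∀ x, H x = H default := fun x ↦ congrArg H (Subsingleton.elim _ _)
    simp [h]
  | succ n ih =>
    intro l
    set Q : Measure (Fin n → Z) := Measure.pi fun _ : Fin n => P
    have hmp := (measurePreserving_piFinSuccAbove (fun _ : Fin (n + 1) => P) 0).symm
    set e := (MeasurableEquiv.piFinSuccAbove (fun _ : Fin (n + 1) => Z) 0).symm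
    have he : ∀ z x, e (z, x) = Fin.cons z x := fun z x ↦ by
      simp [e, MeasurableEquiv.piFinSuccAbove, Fin.insertNthEquiv]
    have htr : ∀ f : (Fin (n + 1) → Z) → ℝ,
        ∫ x, f x ∂(Measure.pi fun _ : Fin (n + 1) => P) = ∫ p, f (e p) ∂(P.prod Q) := fun f ↦
      (hmp.integral_comp' (g := f)).symm
    have hHe : Measurable fun p ↦ H (e p) := hH.comp e.measurable
    have hsec : ∀ z, Measurable fun x ↦ H (e (z, x)) := fun z ↦ hHe.comp measurable_prodMk_left
    have hint : Integrable (fun p ↦ H (e p)) (P.prod Q) :=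
      .of_bound hHe.aestronglyMeasurable M (ae_of_all _ fun p ↦ hM _)
    have hintsec : ∀ z, Integrable (fun x ↦ H (e (z, x))) Q := fun z ↦
      .of_bound (hsec z).aestronglyMeasurable M (ae_of_all _ fun p ↦ hM _)
    set G : Z → ℝ := fun z ↦ ∫ x, H (e (z, x)) ∂Q with hGdef
    have hGmeas : Measurable G :=
      (hHe.stronglyMeasurable.integral_prod_right').measurable
    have hGM : ∀ z, |G z| ≤ M := fun z ↦ by
      simpa using norm_integral_le_of_norm_le_const (μ := Q) (f := fun x ↦ H (e (z, x)))
        (ae_of_all _ fun x ↦ hM _)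
    have hGosc : ∀ z z', |G z - G z'| ≤ c 0 := fun z z' ↦ by
      rw [hGdef, ← integral_sub (hintsec z) (hintsec z')]
      simpa using norm_integral_le_of_norm_le_const (μ := Q)
        (f := fun x ↦ H (e (z, x)) - H (e (z', x))) (C := c 0)
        (ae_of_all _ fun x ↦ hc 0 _ _ fun j hj ↦ by
          obtain ⟨k, rfl⟩ := Fin.exists_succ_eq.2 hj
          simp [he])
    have hinner : ∀ z, ∫ x, exp (l * (H (e (z, x)) - G z)) ∂Q
        ≤ exp (l ^ 2 * ((∑ i : Fin n, c i.succ ^ 2) / 4) / 2) := fun z ↦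
      ih (hsec z) (fun _ ↦ hM _) (fun i d d' hd ↦ hc i.succ _ _ fun j hj ↦ by
        simp only [he]
        refine Fin.cases (fun _ ↦ rfl) (fun k hk ↦ ?_) j hj
        simpa using hd k fun h ↦ hk (h ▸ rfl)) l
    have houter := subGaussian_of_oscillation_le P hGmeas hGosc l
    have hexp : ∀ {X : Type _} [MeasurableSpace X] (R : Measure X) [IsProbabilityMeasure R]
        (f : X → ℝ) (m : ℝ), Measurable f → (∀ x, |f x| ≤ M) →
        Integrable (fun x ↦ exp (l * (f x - m))) R := fun R _ f m hf hfM ↦ by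
      refine .of_bound (by fun_prop) (exp (|l| * (M + |m|))) (ae_of_all _ fun x ↦ ?_)
      rw [norm_eq_abs, abs_exp, exp_le_exp]
      refine (le_abs_self _).trans ?_
      rw [abs_mul]
      gcongr
      exact (abs_sub _ _).trans (by gcongr; exact hfM x)
    rw [htr H, htr, integral_prod _ hint, integral_prod _ (hexp _ _ _ hHe fun _ ↦ hM _)]
    set K := exp (l ^ 2 * ((∑ i : Fin n, c i.succ ^ 2) / 4) / 2) with hK
    calc ∫ z, ∫ x, exp (l * (H (e (z, x)) - ∫ z, G z ∂P)) ∂Q ∂P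
        ≤ ∫ z, exp (l * (G z - ∫ z, G z ∂P)) * K ∂P := by
          refine integral_mono (hexp _ _ _ hHe fun _ ↦ hM _).integral_prod_left
            ((hexp P G _ hGmeas hGM).mul_const K) fun z ↦ ?_
          have hsplit : ∀ x, exp (l * (H (e (z, x)) - ∫ z, G z ∂P))
              = exp (l * (G z - ∫ z, G z ∂P)) * exp (l * (H (e (z, x)) - G z)) := fun x ↦ by
            rw [← exp_add]
            ring_nf
          simp only [hsplit, integral_const_mul]
          gcongr
          exact hinner z
      _ ≤ exp (l ^ 2 * (c 0 ^ 2 / 4) / 2) * K := by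
          rw [integral_mul_const]
          gcongr
      _ = exp (l ^ 2 * ((∑ i, c i ^ 2) / 4) / 2) := by
          rw [hK, ← exp_add, Fin.sum_univ_succ]
          ring_nf

/-- Proposition 1, sub-Gaussianity via stability:
for a `β`-uniformly stable algorithm with loss in `[a, b]`, the generalization
gap on `n` i.i.d. samples is sub-Gaussian with variance proxy
`(n/4) (2β + (b-a)/n)²`. -/
theorem stmt_2 {Z F : Type*} [MeasurableSpace Z] (P : Measure Z) [IsProbabilityMeasure P]
    (n : ℕ) (hn : 0 < n) (ℓ : F → Z → ℝ) (a b : ℝ)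
    (hmeasℓ : ∀ f : F, Measurable (ℓ f))
    (hbdd : ∀ (f : F) (z : Z), ℓ f z ∈ Set.Icc a b)
    (A : (Fin n → Z) → F) (β : ℝ)
    (hstable : ∀ d d' : Fin n → Z, DifferOne d d' →
      ∀ z : Z, |ℓ (A d) z - ℓ (A d') z| ≤ β)
    (H : (Fin n → Z) → ℝ) (hHmeas : Measurable H)
    (hH : ∀ d : Fin n → Z,
      H d = (∫ z, ℓ (A d) z ∂P) - (1 / (n : ℝ)) * ∑ i : Fin n, ℓ (A d) (d i)) :
    SubGaussian (Measure.pi fun _ : Fin n => P) H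
      ((n : ℝ) / 4 * (2 * β + (b - a) / n) ^ 2) := by
  have hnR : (0 : ℝ) < n := by exact_mod_cast hn
  have hint : ∀ f, Integrable (ℓ f) P := fun f ↦
    .of_mem_Icc a b (hmeasℓ f).aemeasurable (ae_of_all _ (hbdd f))
  have habs : ∀ f z, |ℓ f z| ≤ max |a| |b| := fun f z ↦ abs_le_max_abs_abs (hbdd f z).1 (hbdd f z).2
  have hbound : ∀ d, |H d| ≤ max |a| |b| + max |a| |b| := fun d ↦ by
    rw [hH]
    refine (abs_sub _ _).trans (add_le_add ?_ ?_)
    · simpa using norm_integral_le_of_norm_le_const (μ := P) (f := ℓ (A d))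
        (ae_of_all _ (habs (A d)))
    · rw [abs_mul, abs_of_pos (by positivity), one_div, inv_mul_le_iff₀ hnR]
      refine (Finset.abs_sum_le_sum_abs _ _).trans ?_
      simpa using Finset.sum_le_card_nsmul Finset.univ _ _ fun i _ ↦ habs (A d) (d i)
  have hdiff : ∀ (i : Fin n) (d d' : Fin n → Z), (∀ j, j ≠ i → d j = d' j) →
      |H d - H d'| ≤ |2 * β + (b - a) / n| := fun i d d' hd ↦ by
    by_cases hi : d i = d' i
    · have : d = d' := funext fun j ↦ if hj : j = i then hj ▸ hi else hd j hj
      simp [this]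
    have hst := hstable d d' ⟨i, hi, hd⟩
    have hβ : 0 ≤ β := (abs_nonneg _).trans (hst (d i))
    refine le_trans ?_ (le_abs_self _)
    have hrisk : |(∫ z, ℓ (A d) z ∂P) - ∫ z, ℓ (A d') z ∂P| ≤ β := by
      rw [← integral_sub (hint _) (hint _)]
      simpa using norm_integral_le_of_norm_le_const (μ := P)
        (f := fun z ↦ ℓ (A d) z - ℓ (A d') z) (ae_of_all _ hst)
    have hterm : ∀ j, |ℓ (A d) (d j) - ℓ (A d') (d' j)| ≤ β + if j = i then b - a else 0 :=
      fun j ↦ by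
      split_ifs with hj
      · have h₁ := hbdd (A d) (d j)
        have h₂ := hbdd (A d') (d' j)
        rw [abs_le]
        constructor <;> linarith [h₁.1, h₁.2, h₂.1, h₂.2]
      · rw [← hd j hj, add_zero]
        exact hst _
    have hsum : |∑ j, ℓ (A d) (d j) - ∑ j, ℓ (A d') (d' j)| ≤ n * β + (b - a) := by
      rw [← Finset.sum_sub_distrib]
      refine (Finset.abs_sum_le_sum_abs _ _).trans
        ((Finset.sum_le_sum fun j _ ↦ hterm j).trans_eq ?_)
      simp [Finset.sum_add_distrib]
    have hemp : |1 / (n : ℝ) * (∑ j, ℓ (A d) (d j) - ∑ j, ℓ (A d') (d' j))|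
        ≤ β + (b - a) / n := by
      rw [abs_mul, abs_of_pos (by positivity), one_div, inv_mul_le_iff₀ hnR]
      refine hsum.trans_eq ?_
      field_simp
    calc |H d - H d'|
        = |((∫ z, ℓ (A d) z ∂P) - ∫ z, ℓ (A d') z ∂P)
            - 1 / (n : ℝ) * (∑ j, ℓ (A d) (d j) - ∑ j, ℓ (A d') (d' j))| := by
          rw [hH, hH]
          ring_nf
      _ ≤ β + (β + (b - a) / n) := (abs_sub _ _).trans (add_le_add hrisk hemp)
      _ = 2 * β + (b - a) / n := by ring
  have h := subGaussian_pi_of_boundedDifferences P hHmeas hbound hdiff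
  simp only [sq_abs, Finset.sum_const, Finset.card_univ, Fintype.card_fin, nsmul_eq_mul] at h
  convert h using 1
  ring
end

section
/- Let Z be a measurable space, P a probability measure on Z, F a normed vector space, ℓ: F × Z → ℝ a loss taking values in [a, b] such that for every z ∈ Z the map f ↦ ℓ(f, z) is L-Lipschitz, and A: Z^n → F an algorithm satisfying parameter stability ‖A(d) − A(d')‖ ≤ κ/n for any datasets d, d' differing in one coordinate. Define H(d) = E_{z∼P}[ℓ(A(d), z)] − (1/n)∑_{i=1}^n ℓ(A(d), d_i). Then for any two datasets d, d' differing in exactly one coordinate, |H(d) − H(d')| ≤ (2κL + (b − a))/n; consequently, if D_n consists of n i.i.d. samples from P and H is measurable, then H(D_n) is sub-Gaussian under P^{⊗n} with variance proxy σ₀² where σ₀ = (1/√n)(κL + (b − a)/2). -/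
open MeasureTheory Real

section BoundedDifferences

variable {Z : Type*}

/-- Changing coordinate `i` changes the value of `f` by at most `c i`. -/
def HasBoundedDifferences {n : ℕ} (f : (Fin n → Z) → ℝ) (c : Fin n → ℝ) : Prop :=
  ∀ (i : Fin n) (d : Fin n → Z) (z : Z), |f (Function.update d i z) - f d| ≤ c i

namespace HasBoundedDifferences

variable {n : ℕ}

lemma cons {f : (Fin (n + 1) → Z) → ℝ} {c : Fin (n + 1) → ℝ}
    (hf : HasBoundedDifferences f c) (x : Z) :
    HasBoundedDifferences (fun t : Fin n → Z => f (Fin.cons x t)) (fun i => c i.succ) := by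
  intro i d z
  simpa [Fin.cons_update] using hf i.succ (Fin.cons x d) z

lemma abs_cons_sub_cons_le {f : (Fin (n + 1) → Z) → ℝ} {c : Fin (n + 1) → ℝ}
    (hf : HasBoundedDifferences f c) (x y : Z) (t : Fin n → Z) :
    |f (Fin.cons x t) - f (Fin.cons y t)| ≤ c 0 := by
  simpa [Fin.update_cons_zero] using hf 0 (Fin.cons y t) x

lemma abs_sub_le_sum : ∀ {n : ℕ} {f : (Fin n → Z) → ℝ} {c : Fin n → ℝ},
    HasBoundedDifferences f c → ∀ d e : Fin n → Z, |f d - f e| ≤ ∑ i, c i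
  | 0, f, c, _, d, e => by simp [Subsingleton.elim d e]
  | n + 1, f, c, hf, d, e => by
    have h₁ := hf.abs_cons_sub_cons_le (d 0) (e 0) (Fin.tail d)
    have h₂ := abs_sub_le_sum (hf.cons (e 0)) (Fin.tail d) (Fin.tail e)
    simp only [Fin.cons_self_tail] at h₁ h₂
    rw [Fin.sum_univ_succ]
    exact (abs_sub_le _ _ _).trans (add_le_add h₁ h₂)

lemma exists_abs_le {f : (Fin n → Z) → ℝ} {c : Fin n → ℝ} (hf : HasBoundedDifferences f c) :
    ∃ M, ∀ d, |f d| ≤ M := by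
  by_cases h : Nonempty (Fin n → Z)
  · obtain ⟨e⟩ := h
    refine ⟨(∑ i, c i) + |f e|, fun d => ?_⟩
    have h₁ := hf.abs_sub_le_sum d e
    have h₂ := abs_sub_abs_le_abs_sub (f d) (f e)
    linarith
  · exact ⟨0, fun d => (h ⟨d⟩).elim⟩

end HasBoundedDifferences

variable [MeasurableSpace Z]

lemma abs_integral_sub_integral_le {P : Measure Z} [IsProbabilityMeasure P] {f g : Z → ℝ}
    (hf : Integrable f P) (hg : Integrable g P) {C : ℝ} (h : ∀ x, |f x - g x| ≤ C) :
    |(∫ x, f x ∂P) - ∫ x, g x ∂P| ≤ C := by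
  rw [← integral_sub hf hg]
  simpa using norm_integral_le_of_norm_le_const (μ := P) (f := fun x => f x - g x)
    (.of_forall h)

/-- Hoeffding's lemma, in terms of the oscillation of the random variable. -/
lemma integral_exp_mul_sub_integral_le {P : Measure Z} [IsProbabilityMeasure P] {f : Z → ℝ}
    (hf : Measurable f) {c : ℝ} (hc : ∀ x y, |f x - f y| ≤ c) (l : ℝ) :
    ∫ x, exp (l * (f x - ∫ y, f y ∂P)) ∂P ≤ exp (l ^ 2 * (c / 2) ^ 2 / 2) := by
  obtain ⟨z⟩ := P.nonempty_of_neZero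
  have hbdd : BddBelow (Set.range f) := by
    refine ⟨f z - c, ?_⟩
    rintro _ ⟨x, rfl⟩
    linarith [(abs_le.mp (hc z x)).2]
  have hmem : ∀ x, f x ∈ Set.Icc (⨅ y, f y) ((⨅ y, f y) + c) := fun x => by
    have : Nonempty Z := ⟨z⟩
    refine ⟨ciInf_le hbdd x, ?_⟩
    have : f x - c ≤ ⨅ y, f y := le_ciInf fun y => by linarith [(abs_le.mp (hc x y)).2]
    linarith
  have h := (ProbabilityTheory.hasSubgaussianMGF_of_mem_Icc hf.aemeasurable
    (Filter.Eventually.of_forall hmem) (μ := P)).mgf_le l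
  refine h.trans_eq ?_
  congr 1
  push_cast
  simp only [add_sub_cancel_left, Real.norm_eq_abs, div_pow, sq_abs]
  ring

/-- **McDiarmid's inequality**, in its moment generating function form. -/
theorem HasBoundedDifferences.integral_exp_mul_sub_integral_le
    (P : Measure Z) [IsProbabilityMeasure P] (l : ℝ) :
    ∀ {n : ℕ} {f : (Fin n → Z) → ℝ} {c : Fin n → ℝ}, Measurable f → HasBoundedDifferences f c →
    ∫ x, exp (l * (f x - ∫ y, f y ∂Measure.pi fun _ => P)) ∂(Measure.pi fun _ => P) ≤
      exp (l ^ 2 * (∑ i, (c i / 2) ^ 2) / 2)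
  | 0, f, c, _, _ => by
    simp [Measure.pi_of_empty (fun _ : Fin 0 => P) Fin.elim0]
  | n + 1, f, c, hfm, hf => by
    obtain ⟨M, hM⟩ := hf.exists_abs_le
    let Q : Measure (Fin n → Z) := Measure.pi fun _ => P
    have hcons : Measurable fun p : (Fin n → Z) × Z => f (Fin.cons p.2 p.1) := by
      refine hfm.comp (measurable_pi_iff.mpr fun i => ?_)
      refine Fin.cases ?_ (fun j => ?_) i
      · simpa using measurable_snd
      · simpa [Function.comp_def] using (measurable_pi_apply j).comp measurable_fst
    have hx : ∀ t, Measurable fun x => f (Fin.cons x t) := fun t =>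
      hcons.comp measurable_prodMk_left
    have hxint : ∀ t, Integrable (fun x => f (Fin.cons x t)) P := fun t =>
      .of_bound (hx t).aestronglyMeasurable M (.of_forall fun x => hM _)
    have key : ∀ φ : ℝ → ℝ, Continuous φ →
        Integrable (fun p : (Fin n → Z) × Z => φ (f (Fin.cons p.2 p.1))) (Q.prod P) ∧
        ∫ d, φ (f d) ∂(Measure.pi fun _ => P) = ∫ t, ∫ x, φ (f (Fin.cons x t)) ∂P ∂Q := by
      intro φ hφ
      obtain ⟨K, hK⟩ := (isCompact_Icc (a := -M) (b := M)).exists_bound_of_continuousOn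
        hφ.continuousOn
      have hint : Integrable (fun p : (Fin n → Z) × Z => φ (f (Fin.cons p.2 p.1))) (Q.prod P) :=
        .of_bound (hφ.measurable.comp hcons).aestronglyMeasurable K
          (.of_forall fun p => hK _ (abs_le.mp (hM _)))
      refine ⟨hint, ?_⟩
      rw [← integral_prod _ hint, ← integral_prod_swap]
      have hmp := measurePreserving_piFinSuccAbove (fun _ : Fin (n + 1) => P) 0
      rw [← hmp.symm.integral_comp (MeasurableEquiv.measurableEmbedding _)]
      simp [MeasurableEquiv.piFinSuccAbove, Fin.insertNthEquiv, Q]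
    let g : (Fin n → Z) → ℝ := fun t => ∫ x, f (Fin.cons x t) ∂P
    have hgm : Measurable g :=
      hcons.stronglyMeasurable.integral_prod_right.measurable
    have hg : HasBoundedDifferences g fun i => c i.succ := by
      intro i d z
      exact abs_integral_sub_integral_le (hxint _) (hxint _) fun x => hf.cons x i d z
    have hmean : ∫ d, f d ∂(Measure.pi fun _ => P) = ∫ t, g t ∂Q := (key id continuous_id).2
    have ih := integral_exp_mul_sub_integral_le P l hgm hg
    set m := ∫ t, g t ∂Q
    obtain ⟨hint, hexp⟩ := key (fun y => exp (l * (y - m))) (by fun_prop)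
    obtain ⟨N, hN⟩ := hg.exists_abs_le
    have hgint : Integrable (fun t => exp (l * (g t - m))) Q := by
      obtain ⟨K, hK⟩ := (isCompact_Icc (a := -N) (b := N)).exists_bound_of_continuousOn
        (f := fun y => exp (l * (y - m))) (by fun_prop)
      exact .of_bound (by fun_prop) K (.of_forall fun t => hK _ (abs_le.mp (hN t)))
    rw [hmean, hexp]
    calc ∫ t, ∫ x, exp (l * (f (Fin.cons x t) - m)) ∂P ∂Q
        ≤ ∫ t, exp (l * (g t - m)) * exp (l ^ 2 * (c 0 / 2) ^ 2 / 2) ∂Q := by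
          refine integral_mono hint.integral_prod_left (hgint.mul_const _) fun t => ?_
          have h := _root_.integral_exp_mul_sub_integral_le (P := P) (hx t)
            (fun x y => hf.abs_cons_sub_cons_le x y t) l
          have hsplit : ∀ x, exp (l * (f (Fin.cons x t) - m)) =
              exp (l * (g t - m)) * exp (l * (f (Fin.cons x t) - g t)) := fun x => by
            rw [← exp_add]; ring_nf
          simp only [hsplit, integral_const_mul]
          exact mul_le_mul_of_nonneg_left h (exp_nonneg _)
      _ ≤ exp (l ^ 2 * (∑ i : Fin n, (c i.succ / 2) ^ 2) / 2) *
            exp (l ^ 2 * (c 0 / 2) ^ 2 / 2) := by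
          rw [integral_mul_const]
          exact mul_le_mul_of_nonneg_right ih (exp_nonneg _)
      _ = exp (l ^ 2 * (∑ i, (c i / 2) ^ 2) / 2) := by
          rw [← exp_add, Fin.sum_univ_succ]; ring_nf

end BoundedDifferences

/-- appendix lemma, standard proxy `σ₀`: for an `L`-Lipschitz
bounded loss and a parameter-stable algorithm, the generalization gap has
bounded differences `(2κL + (b−a))/n` and is sub-Gaussian with proxy
`σ₀ = (1/√n)(κL + (b−a)/2)`. -/
theorem stmt_7 {Z : Type*} [MeasurableSpace Z] {F : Type*}
    [NormedAddCommGroup F] [NormedSpace ℝ F]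
    (P : Measure Z) [IsProbabilityMeasure P]
    (n : ℕ) (hn : 0 < n) (ℓ : F → Z → ℝ) (a b L : ℝ) (hL : 0 ≤ L)
    (hmeasℓ : ∀ f : F, Measurable (ℓ f))
    (hbdd : ∀ (f : F) (z : Z), ℓ f z ∈ Set.Icc a b)
    (hlip : ∀ (z : Z) (f f' : F), |ℓ f z - ℓ f' z| ≤ L * ‖f - f'‖)
    (A : (Fin n → Z) → F) (κ : ℝ)
    (hstable : ∀ d d' : Fin n → Z, DifferOne d d' → ‖A d - A d'‖ ≤ κ / n)
    (H : (Fin n → Z) → ℝ) (hHmeas : Measurable H)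
    (hH : ∀ d : Fin n → Z,
      H d = (∫ z, ℓ (A d) z ∂P) - (1 / (n : ℝ)) * ∑ i : Fin n, ℓ (A d) (d i)) :
    (∀ d d' : Fin n → Z, DifferOne d d' →
        |H d - H d'| ≤ (2 * κ * L + (b - a)) / n) ∧
    SubGaussian (Measure.pi fun _ : Fin n => P) H
      ((1 / Real.sqrt n * (κ * L + (b - a) / 2)) ^ 2) := by

  have hn' : (0 : ℝ) < n := Nat.cast_pos.mpr hn
  have hdiff : ∀ d d' : Fin n → Z, DifferOne d d' →
      |H d - H d'| ≤ (2 * κ * L + (b - a)) / n := by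
    intro d d' hd
    have hLip : ∀ z, |ℓ (A d) z - ℓ (A d') z| ≤ L * (κ / n) := fun z =>
      (hlip z _ _).trans (mul_le_mul_of_nonneg_left (hstable d d' hd) hL)
    have hint : ∀ f, Integrable (ℓ f) P := fun f =>
      .of_mem_Icc a b (hmeasℓ f).aemeasurable (.of_forall (hbdd f))
    have hrisk : |(∫ z, ℓ (A d) z ∂P) - ∫ z, ℓ (A d') z ∂P| ≤ L * (κ / n) :=
      abs_integral_sub_integral_le (hint _) (hint _) hLip
    obtain ⟨i, -, hi⟩ := hd
    have hterm : ∀ j, |ℓ (A d) (d j) - ℓ (A d') (d' j)| ≤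
        L * (κ / n) + if j = i then b - a else 0 := by
      intro j
      have h₁ := abs_sub_le (ℓ (A d) (d j)) (ℓ (A d') (d j)) (ℓ (A d') (d' j))
      have h₂ := hLip (d j)
      split_ifs with hj
      · have h₃ : |ℓ (A d') (d j) - ℓ (A d') (d' j)| ≤ b - a :=
          abs_sub_le_of_le_of_le (hbdd _ _).1 (hbdd _ _).2 (hbdd _ _).1 (hbdd _ _).2
        linarith
      · rw [← hi j hj] at h₁ ⊢
        simpa using h₂
    have hemp : |∑ j, ℓ (A d) (d j) - ∑ j, ℓ (A d') (d' j)| ≤ L * κ + (b - a) := by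
      rw [← Finset.sum_sub_distrib]
      refine (Finset.abs_sum_le_sum_abs _ _).trans
        ((Finset.sum_le_sum fun j _ => hterm j).trans_eq ?_)
      simp [Finset.sum_add_distrib]
      field_simp
    have hsplit : H d - H d' = ((∫ z, ℓ (A d) z ∂P) - ∫ z, ℓ (A d') z ∂P) -
        1 / (n : ℝ) * (∑ j, ℓ (A d) (d j) - ∑ j, ℓ (A d') (d' j)) := by
      rw [hH, hH]; ring
    rw [hsplit]
    refine (abs_sub _ _).trans ?_
    rw [abs_mul, abs_of_pos (one_div_pos.mpr hn')]
    refine (add_le_add hrisk (mul_le_mul_of_nonneg_left hemp (one_div_pos.mpr hn').le)).trans_eq ?_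
    field_simp
    ring
  refine ⟨hdiff, fun l => ?_⟩
  rcases subsingleton_or_nontrivial Z with hZ | hZ
  · obtain ⟨d₀⟩ := (Measure.pi fun _ : Fin n => P).nonempty_of_neZero
    have hconst : ∀ d, H d = H d₀ := fun d => by rw [Subsingleton.elim d d₀]
    simp only [hconst, integral_const, probReal_univ, one_smul, sub_self, mul_zero, exp_zero]
    exact one_le_exp (by positivity)
  · have hc : 0 ≤ (2 * κ * L + (b - a)) / n := by
      obtain ⟨x, y, hxy⟩ := exists_pair_ne Z
      refine (abs_nonneg _).trans (hdiff (fun _ => x) (Function.update (fun _ => x) ⟨0, hn⟩ y)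
        ⟨⟨0, hn⟩, by simpa using hxy, fun j hj => by simp [hj]⟩)
    have hH' : HasBoundedDifferences H fun _ => (2 * κ * L + (b - a)) / n := by
      intro i d z
      by_cases hz : z = d i
      · simpa [hz] using hc
      · exact hdiff _ _ ⟨i, by simpa using hz, fun j hj => by simp [hj]⟩
    refine (hH'.integral_exp_mul_sub_integral_le P l hHmeas).trans_eq ?_
    congr 1
    rw [mul_pow, div_pow 1, Real.sq_sqrt hn'.le]
    simp only [Finset.sum_const, Finset.card_univ, Fintype.card_fin, nsmul_eq_mul]
    field_simp
end

section
/- Let Z be a measurable space, ℓ: ℝ^m × Z → ℝ a loss, and A: Z^n → ℝ^m an algorithm satisfying parameter stability ‖A(d) − A(d')‖ ≤ κ/n for datasets differing in one coordinate. Fix ρ > 0 and suppose that for every z ∈ Z the map f ↦ ℓ(f, z) is twice differentiable with ‖∇²_f ℓ(·, z)‖_op ≤ α and ‖∇_f ℓ(A(d), z)‖ ≤ g₀ on the ρ-neighborhood of the segment joining A(d) and A(d') for all neighboring datasets d, d'. Let U be the uniform measure on the closed ball of radius ρ in ℝ^m and define the empirical sharpness S_d = E_{u∼U}[(1/n)∑_{i=1}^n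 ℓ(A(d)+u, d_i)] − (1/n)∑_{i=1}^n ℓ(A(d), d_i). Then S has bounded differences with constants (ακρ + 2g₀ρ + αρ²)/n, and for D_n consisting of n i.i.d. samples from a probability measure P on Z (with S measurable), S_{D_n} is sub-Gaussian under P^{⊗n} with variance proxy ν(ρ)² where ν(ρ) = (1/√n)((ακ/2)ρ + g₀ρ + (α/2)ρ²). -/
open MeasureTheory Real

theorem abs_integral_le_of_ae_abs_le {Ω : Type*} [MeasurableSpace Ω] {μ : Measure Ω}
    [IsProbabilityMeasure μ] {f : Ω → ℝ} {C : ℝ} (h : ∀ᵐ x ∂μ, |f x| ≤ C) :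
    |∫ x, f x ∂μ| ≤ C := by
  simpa using norm_integral_le_of_norm_le_const (μ := μ) (f := f) h

section BoundedDifferences

variable {Z : Type*}

theorem exists_abs_le_of_bounded_differences [Nonempty Z] {c : ℝ} :
    ∀ (n : ℕ) (F : (Fin n → Z) → ℝ),
      (∀ (i : Fin n) (d d' : Fin n → Z), (∀ j, j ≠ i → d j = d' j) → |F d - F d'| ≤ c) →
      ∃ C, ∀ d, |F d| ≤ C
  | 0, F, _ => ⟨|F Fin.elim0|, fun d => by rw [Subsingleton.elim d Fin.elim0]⟩
  | n + 1, F, hF => by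
    obtain ⟨z₀⟩ := ‹Nonempty Z›
    obtain ⟨C, hC⟩ := exists_abs_le_of_bounded_differences n (fun y => F (Fin.cons z₀ y))
      fun i d d' h => hF i.succ _ _ fun j => by
        refine Fin.cases (fun _ => rfl) (fun k hk => ?_) j
        simpa using h k fun hki => hk (by rw [hki])
    refine ⟨C + c, fun d => ?_⟩
    have h₁ := hC (Fin.tail d)
    have h₂ := hF 0 d (Fin.cons z₀ (Fin.tail d)) fun j hj => by
      obtain ⟨k, rfl⟩ := Fin.exists_succ_eq.2 hj
      simp [Fin.tail]
    grind

variable [MeasurableSpace Z]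

theorem measurable_fin_cons (n : ℕ) :
    Measurable fun p : Z × (Fin n → Z) => (Fin.cons p.1 p.2 : Fin (n + 1) → Z) := by
  refine measurable_pi_iff.2 fun j => ?_
  refine Fin.cases ?_ (fun k => ?_) j
  · simpa using measurable_fst
  · simpa using measurable_pi_iff.1 measurable_snd k

theorem measurePreserving_fin_cons (n : ℕ) (P : Measure Z) [IsProbabilityMeasure P] :
    MeasurePreserving (fun p : Z × (Fin n → Z) => (Fin.cons p.1 p.2 : Fin (n + 1) → Z))
      (P.prod (Measure.pi fun _ => P)) (Measure.pi fun _ => P) := by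
  convert (measurePreserving_piFinSuccAbove (fun _ : Fin (n + 1) => P) 0).symm using 1
  ext p : 1
  simp [MeasurableEquiv.piFinSuccAbove, Fin.insertNthEquiv]

theorem integral_pi_fin_succ {n : ℕ} (P : Measure Z) [IsProbabilityMeasure P]
    {H : (Fin (n + 1) → Z) → ℝ} (hm : Measurable H) {C : ℝ} (hC : ∀ d, |H d| ≤ C) :
    Integrable (fun p : Z × (Fin n → Z) => H (Fin.cons p.1 p.2))
        (P.prod (Measure.pi fun _ => P)) ∧
      ∫ d, H d ∂(Measure.pi fun _ => P) =
        ∫ z, ∫ y, H (Fin.cons z y) ∂(Measure.pi fun _ => P) ∂P := by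
  have hi : Integrable (fun p : Z × (Fin n → Z) => H (Fin.cons p.1 p.2))
      (P.prod (Measure.pi fun _ => P)) :=
    Integrable.of_bound (hm.comp (measurable_fin_cons n)).aestronglyMeasurable C
      (.of_forall fun _ => hC _)
  refine ⟨hi, ?_⟩
  rw [← integral_prod _ hi, ← (measurePreserving_fin_cons n P).map_eq, integral_map
    (measurable_fin_cons n).aemeasurable hm.aestronglyMeasurable]

/-- Hoeffding's lemma for a function with oscillation at most `c`. -/
theorem subGaussian_of_oscillation (P : Measure Z) [IsProbabilityMeasure P] {G : Z → ℝ}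
    (hm : Measurable G) {c : ℝ} (hG : ∀ z z', |G z - G z'| ≤ c) :
    (∀ l : ℝ, Integrable (fun x => Real.exp (l * (G x - ∫ y, G y ∂P))) P) ∧
      SubGaussian P G (c ^ 2 / 4) := by
  obtain ⟨z₀⟩ : Nonempty Z := nonempty_of_isProbabilityMeasure P
  have : Nonempty Z := ⟨z₀⟩
  have hc : 0 ≤ c := (abs_nonneg _).trans (hG z₀ z₀)
  have hbdd : BddBelow (Set.range G) := ⟨G z₀ - c, by
    rintro _ ⟨z, rfl⟩
    linarith [(abs_le.1 (hG z z₀)).1]⟩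
  have hIcc : ∀ z, G z ∈ Set.Icc (⨅ z, G z) ((⨅ z, G z) + c) := fun z =>
    ⟨ciInf_le hbdd z, by
      have : G z - c ≤ ⨅ z, G z := le_ciInf fun z' => by linarith [(abs_le.1 (hG z z')).2]
      linarith⟩
  have h := ProbabilityTheory.hasSubgaussianMGF_of_mem_Icc hm.aemeasurable
    (.of_forall hIcc : ∀ᵐ z ∂P, _)
  refine ⟨h.integrable_exp_mul, fun l => (h.mgf_le l).trans_eq ?_⟩
  congr 1
  simp only [add_sub_cancel_left, NNReal.coe_pow, NNReal.coe_div, coe_nnnorm, norm_eq_abs,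
    abs_of_nonneg hc, NNReal.coe_ofNat]
  ring

/-- McDiarmid's inequality, in moment-generating-function form. -/
theorem subGaussian_pi_of_bounded_differences (P : Measure Z) [IsProbabilityMeasure P] {c : ℝ} :
    ∀ (n : ℕ) (F : (Fin n → Z) → ℝ), Measurable F →
      (∀ (i : Fin n) (d d' : Fin n → Z), (∀ j, j ≠ i → d j = d' j) → |F d - F d'| ≤ c) →
      SubGaussian (Measure.pi fun _ : Fin n => P) F (n * c ^ 2 / 4)
  | 0, F, _, _ => fun l => by
    have : ∀ x, F x = F Fin.elim0 := fun x => by rw [Subsingleton.elim x Fin.elim0]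
    simp [this]
  | n + 1, F, hm, hF => fun l => by
    have : Nonempty Z := nonempty_of_isProbabilityMeasure P
    set μ : Measure (Fin n → Z) := Measure.pi fun _ => P
    obtain ⟨C, hC⟩ := exists_abs_le_of_bounded_differences (n + 1) F hF
    obtain ⟨hFi, hFint⟩ := integral_pi_fin_succ P hm hC
    set M := ∫ y, F y ∂(Measure.pi fun _ : Fin (n + 1) => P)
    have hexp : ∀ d, |Real.exp (l * (F d - M))| ≤ Real.exp (|l| * (C + |M|)) := fun d => by
      rw [abs_of_pos (Real.exp_pos _), Real.exp_le_exp]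
      refine (le_abs_self _).trans ?_
      rw [abs_mul]
      gcongr
      exact (abs_sub _ _).trans (by gcongr; exact hC d)
    obtain ⟨hEi, hEint⟩ := integral_pi_fin_succ P (H := fun d => Real.exp (l * (F d - M)))
      (by fun_prop) hexp
    have hslice : ∀ z, Measurable fun y : Fin n → Z => F (Fin.cons z y) := fun z =>
      hm.comp ((measurable_fin_cons n).comp measurable_prodMk_left)
    set G : Z → ℝ := fun z => ∫ y, F (Fin.cons z y) ∂μ with hGdef
    have hGm : Measurable G :=
      ((hm.comp (measurable_fin_cons n)).stronglyMeasurable.integral_prod_right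
        (f := fun z y => F (Fin.cons z y))).measurable
    have hsi : ∀ z, Integrable (fun y => F (Fin.cons z y)) μ := fun z =>
      Integrable.of_bound (hslice z).aestronglyMeasurable C (.of_forall fun _ => hC _)
    have hGosc : ∀ z z', |G z - G z'| ≤ c := fun z z' => by
      rw [hGdef, ← integral_sub (hsi z) (hsi z')]
      refine abs_integral_le_of_ae_abs_le (.of_forall fun y => ?_)
      refine hF 0 _ _ fun j hj => ?_
      obtain ⟨k, rfl⟩ := Fin.exists_succ_eq.2 hj
      simp
    obtain ⟨hGi, hG⟩ := subGaussian_of_oscillation P hGm hGosc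
    have hIH : ∀ z, ∫ y, Real.exp (l * (F (Fin.cons z y) - M)) ∂μ ≤
        Real.exp (l ^ 2 * (n * c ^ 2 / 4) / 2) * Real.exp (l * (G z - M)) := fun z => by
      have h := subGaussian_pi_of_bounded_differences P n (fun y => F (Fin.cons z y)) (hslice z)
        (fun i d d' h => hF i.succ _ _ fun j => by
          refine Fin.cases (fun _ => rfl) (fun k hk => ?_) j
          simpa using h k fun hki => hk (by rw [hki])) l
      have heq : ∀ y, Real.exp (l * (F (Fin.cons z y) - M)) =
          Real.exp (l * (F (Fin.cons z y) - G z)) * Real.exp (l * (G z - M)) := fun y => by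
        rw [← Real.exp_add]
        ring_nf
      simp_rw [heq]
      rw [integral_mul_const]
      gcongr
    rw [hEint]
    have hGl := hG l
    have hGil := hGi l
    rw [← hFint] at hGl hGil
    calc ∫ z, ∫ y, Real.exp (l * (F (Fin.cons z y) - M)) ∂μ ∂P
        ≤ ∫ z, Real.exp (l ^ 2 * (n * c ^ 2 / 4) / 2) * Real.exp (l * (G z - M)) ∂P :=
          integral_mono hEi.integral_prod_left (hGil.const_mul _) hIH
      _ = Real.exp (l ^ 2 * (n * c ^ 2 / 4) / 2) * ∫ z, Real.exp (l * (G z - M)) ∂P :=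
          integral_const_mul _ _
      _ ≤ Real.exp (l ^ 2 * (n * c ^ 2 / 4) / 2) * Real.exp (l ^ 2 * (c ^ 2 / 4) / 2) := by
          gcongr
      _ = Real.exp (l ^ 2 * ((n + 1 : ℕ) * c ^ 2 / 4) / 2) := by
          rw [← Real.exp_add]
          push_cast
          ring_nf

end BoundedDifferences

section HessianBound

variable {E : Type*} [NormedAddCommGroup E] [NormedSpace ℝ E] {φ : E → ℝ} {s : Set E} {α : ℝ}

theorem abs_sub_le_of_hessian_bound (hs : Convex ℝ s)
    (hφ : ∀ x ∈ s, DifferentiableAt ℝ φ x) (hφ' : ∀ x ∈ s, DifferentiableAt ℝ (fderiv ℝ φ) x)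
    (hα : ∀ x ∈ s, ‖fderiv ℝ (fderiv ℝ φ) x‖ ≤ α) {x u : E} (hx : x ∈ s) (hxu : x + u ∈ s)
    {g : ℝ} (hg : ‖fderiv ℝ φ x‖ ≤ g) :
    |φ (x + u) - φ x| ≤ g * ‖u‖ + α / 2 * ‖u‖ ^ 2 := by
  have hmem : ∀ t ∈ Set.Icc (0 : ℝ) 1, x + t • u ∈ s := fun t ht =>
    hs.add_smul_mem hx hxu ht
  have hd : ∀ t ∈ Set.Icc (0 : ℝ) 1,
      HasDerivAt (fun t : ℝ => φ (x + t • u) - φ x) (fderiv ℝ φ (x + t • u) u) t := fun t ht => by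
    have h₁ : HasDerivAt (fun t : ℝ => x + t • u) u t := by
      simpa using ((hasDerivAt_id t).smul_const u).const_add x
    exact ((hφ _ (hmem t ht)).hasFDerivAt.comp_hasDerivAt t h₁).sub_const _
  have hB : ∀ t : ℝ, HasDerivAt (fun t : ℝ => g * ‖u‖ * t + α / 2 * ‖u‖ ^ 2 * t ^ 2)
      (g * ‖u‖ + α * ‖u‖ ^ 2 * t) t := fun t => by
    refine (((hasDerivAt_id' t).const_mul (g * ‖u‖)).add
      ((hasDerivAt_pow 2 t).const_mul (α / 2 * ‖u‖ ^ 2))).congr_deriv ?_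
    push_cast
    ring
  have key := image_norm_le_of_norm_deriv_right_le_deriv_boundary
    (fun t ht => (hd t ht).continuousAt.continuousWithinAt)
    (fun t ht => (hd t (Set.Ico_subset_Icc_self ht)).hasDerivWithinAt) (by simp) hB
    (fun t ht => by
      have ht' := Set.Ico_subset_Icc_self ht
      have h₁ := hs.norm_image_sub_le_of_norm_fderiv_le hφ' hα hx (hmem t ht')
      rw [add_sub_cancel_left, norm_smul, norm_of_nonneg ht'.1] at h₁
      have h₂ : ‖fderiv ℝ φ (x + t • u)‖ ≤ g + α * (t * ‖u‖) := by
        have := norm_le_norm_add_norm_sub' (fderiv ℝ φ (x + t • u)) (fderiv ℝ φ x)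
        linarith
      calc ‖fderiv ℝ φ (x + t • u) u‖ ≤ ‖fderiv ℝ φ (x + t • u)‖ * ‖u‖ :=
            ContinuousLinearMap.le_opNorm _ _
        _ ≤ (g + α * (t * ‖u‖)) * ‖u‖ := by gcongr
        _ = g * ‖u‖ + α * ‖u‖ ^ 2 * t := by ring)
    (Set.right_mem_Icc.2 zero_le_one)
  simpa using key

theorem abs_second_difference_le_of_hessian_bound (hs : Convex ℝ s)
    (hφ : ∀ x ∈ s, DifferentiableAt ℝ φ x) (hφ' : ∀ x ∈ s, DifferentiableAt ℝ (fderiv ℝ φ) x)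
    (hα : ∀ x ∈ s, ‖fderiv ℝ (fderiv ℝ φ) x‖ ≤ α) {x y u : E}
    (hxy : segment ℝ x y ⊆ s) (hu : ∀ w ∈ segment ℝ x y, w + u ∈ s) :
    |φ (x + u) - φ x - (φ (y + u) - φ y)| ≤ α * ‖u‖ * ‖x - y‖ := by
  refine (convex_segment x y).norm_image_sub_le_of_norm_hasFDerivWithin_le
    (f := fun w => φ (w + u) - φ w) (f' := fun w => fderiv ℝ φ (w + u) - fderiv ℝ φ w)
    (fun w hw => ?_) (fun w hw => ?_) (right_mem_segment ℝ x y) (left_mem_segment ℝ x y)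
  · exact (((hasFDerivAt_comp_add_right u).2 (hφ _ (hu w hw)).hasFDerivAt).sub
      (hφ _ (hxy hw)).hasFDerivAt).hasFDerivWithinAt
  · simpa using hs.norm_image_sub_le_of_norm_fderiv_le hφ' hα (hxy hw) (hu w hw)

end HessianBound

/-- appendix lemma, proxy `ν(ρ)` for the empirical sharpness. -/
theorem stmt_9 {Z : Type*} [MeasurableSpace Z] (m : ℕ)
    (n : ℕ) (hn : 0 < n) (ℓ : EuclideanSpace ℝ (Fin m) → Z → ℝ)
    (hmeasℓ : ∀ f, Measurable (ℓ f))
    (A : (Fin n → Z) → EuclideanSpace ℝ (Fin m)) (κ : ℝ)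
    (hstable : ∀ d d' : Fin n → Z, DifferOne d d' → ‖A d - A d'‖ ≤ κ / n)
    (ρ α g₀ : ℝ) (hρ : 0 < ρ) (hα : 0 ≤ α) (hg₀ : 0 ≤ g₀)
    -- twice differentiable with `‖∇²ℓ(·,z)‖_op ≤ α` on the ρ-neighborhood of the
    -- segment joining `A d` and `A d'`, for all neighboring datasets `d, d'`
    (hreg : ∀ d d' : Fin n → Z, DifferOne d d' →
      ∀ f : EuclideanSpace ℝ (Fin m),
        (∃ g ∈ segment ℝ (A d) (A d'), ‖f - g‖ ≤ ρ) →
        ∀ z : Z,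
          DifferentiableAt ℝ (fun g => ℓ g z) f ∧
          DifferentiableAt ℝ (fderiv ℝ (fun g => ℓ g z)) f ∧
          ‖fderiv ℝ (fderiv ℝ (fun g => ℓ g z)) f‖ ≤ α)
    -- gradient bound at the algorithm output
    (hgrad : ∀ (d : Fin n → Z) (z : Z), ‖fderiv ℝ (fun g => ℓ g z) (A d)‖ ≤ g₀)
    -- the uniform measure on the closed ball of radius ρ
    (U : Measure (EuclideanSpace ℝ (Fin m)))
    (hUdef : U = (volume (Metric.closedBall (0 : EuclideanSpace ℝ (Fin m)) ρ))⁻¹ •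
      volume.restrict (Metric.closedBall (0 : EuclideanSpace ℝ (Fin m)) ρ))
    -- the empirical sharpness
    (S : (Fin n → Z) → ℝ) (hSmeas : Measurable S)
    (hSdef : ∀ d : Fin n → Z,
      S d = (∫ u, (1 / (n : ℝ)) * ∑ i : Fin n, ℓ (A d + u) (d i) ∂U) -
        (1 / (n : ℝ)) * ∑ i : Fin n, ℓ (A d) (d i))
    (P : Measure Z) [IsProbabilityMeasure P] :
    (∀ d d' : Fin n → Z, DifferOne d d' →
        |S d - S d'| ≤ (α * κ * ρ + 2 * g₀ * ρ + α * ρ ^ 2) / n) ∧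
    SubGaussian (Measure.pi fun _ : Fin n => P) S
      ((1 / Real.sqrt n * (α * κ / 2 * ρ + g₀ * ρ + α / 2 * ρ ^ 2)) ^ 2) := by
  set B := Metric.closedBall (0 : EuclideanSpace ℝ (Fin m)) ρ with hB
  have hU : IsProbabilityMeasure U := ⟨by
    rw [hUdef, Measure.smul_apply, Measure.restrict_apply_univ, smul_eq_mul]
    exact ENNReal.inv_mul_cancel (Metric.measure_closedBall_pos _ _ hρ).ne'
      measure_closedBall_lt_top.ne⟩
  have hUae : ∀ᵐ u ∂U, ‖u‖ ≤ ρ := by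
    rw [hUdef]
    refine Measure.ae_smul_measure ?_ _
    filter_upwards [ae_restrict_mem Metric.isClosed_closedBall.measurableSet] with u hu
    simpa [hB] using hu
  have hUint : ∀ φ : EuclideanSpace ℝ (Fin m) → ℝ, ContinuousOn φ B → Integrable φ U := by
    intro φ hφ
    rw [hUdef]
    exact (hφ.integrableOn_compact (isCompact_closedBall _ _)).smul_measure
      (ENNReal.inv_ne_top.2 (Metric.measure_closedBall_pos _ _ hρ).ne')
  have hn' : (0 : ℝ) < n := Nat.cast_pos.2 hn
  have hbd : ∀ d d' : Fin n → Z, DifferOne d d' →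
      |S d - S d'| ≤ (α * κ * ρ + 2 * g₀ * ρ + α * ρ ^ 2) / n := by
    intro d d' hdd
    set K := Set.image2 (· + ·) (segment ℝ (A d) (A d')) B with hK
    have hKc : Convex ℝ K := (convex_segment _ _).add (convex_closedBall _ _)
    have hKadd : ∀ w ∈ segment ℝ (A d) (A d'), ∀ u, ‖u‖ ≤ ρ → w + u ∈ K := fun w hw u hu =>
      Set.mem_image2_of_mem hw (by simpa [hB] using hu)
    have hseg : segment ℝ (A d) (A d') ⊆ K := fun w hw => by
      simpa using hKadd w hw 0 (by simpa using hρ.le)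
    have hKreg : ∀ z, ∀ f ∈ K, DifferentiableAt ℝ (fun g => ℓ g z) f ∧
          DifferentiableAt ℝ (fderiv ℝ (fun g => ℓ g z)) f ∧
          ‖fderiv ℝ (fderiv ℝ (fun g => ℓ g z)) f‖ ≤ α := by
      rintro z _ ⟨w, hw, u, hu, rfl⟩
      exact hreg d d' hdd _ ⟨w, hw, by simpa [hB] using hu⟩ z
    have hint : ∀ a ∈ segment ℝ (A d) (A d'), ∀ z, Integrable (fun u => ℓ (a + u) z) U :=
      fun a ha z => hUint _ fun u hu => by
        have h₁ := (hKreg z _ (hKadd a ha u (by simpa [hB] using hu))).1.continuousAt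
        exact (ContinuousAt.comp (f := fun u => a + u) (g := fun g => ℓ g z) h₁
          (by fun_prop)).continuousWithinAt
    set φ : EuclideanSpace ℝ (Fin m) → Z → ℝ := fun a z => ∫ u, (ℓ (a + u) z - ℓ a z) ∂U with hφ
    have hS : ∀ e : Fin n → Z, A e ∈ segment ℝ (A d) (A d') →
        S e = (1 / (n : ℝ)) * ∑ i, φ (A e) (e i) := fun e he => by
      have : ∀ z, φ (A e) z = (∫ u, ℓ (A e + u) z ∂U) - ℓ (A e) z := fun z => by
        rw [hφ]
        simp only
        rw [integral_sub (hint _ he z) (integrable_const _)]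
        simp
      rw [hSdef, integral_const_mul, integral_finsetSum _ fun i _ => hint _ he _, ← mul_sub,
        ← Finset.sum_sub_distrib]
      simp_rw [this]
    have hd := left_mem_segment ℝ (A d) (A d')
    have hd' := right_mem_segment ℝ (A d) (A d')
    have hκ : 0 ≤ κ / n := (norm_nonneg _).trans (hstable d d' hdd)
    have hfirst : ∀ e : Fin n → Z, A e ∈ segment ℝ (A d) (A d') → ∀ z,
        |φ (A e) z| ≤ g₀ * ρ + α / 2 * ρ ^ 2 := fun e he z => by
      refine abs_integral_le_of_ae_abs_le ?_
      filter_upwards [hUae] with u hu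
      refine (abs_sub_le_of_hessian_bound (φ := fun g => ℓ g z) hKc (fun f hf => (hKreg z f hf).1)
        (fun f hf => (hKreg z f hf).2.1) (fun f hf => (hKreg z f hf).2.2) (hseg he)
        (hKadd _ he u hu) (hgrad e z)).trans ?_
      gcongr
    have hsecond : ∀ z, |φ (A d) z - φ (A d') z| ≤ α * ρ * (κ / n) := fun z => by
      rw [hφ]
      simp only
      have hi : ∀ a ∈ segment ℝ (A d) (A d'), Integrable (fun u => ℓ (a + u) z - ℓ a z) U :=
        fun a ha => (hint a ha z).sub (integrable_const _)
      rw [← integral_sub (hi _ hd) (hi _ hd')]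
      refine abs_integral_le_of_ae_abs_le ?_
      filter_upwards [hUae] with u hu
      refine (abs_second_difference_le_of_hessian_bound (φ := fun g => ℓ g z) hKc
        (fun f hf => (hKreg z f hf).1) (fun f hf => (hKreg z f hf).2.1)
        (fun f hf => (hKreg z f hf).2.2) hseg fun w hw => hKadd w hw u hu).trans ?_
      gcongr
      exact hstable d d' hdd
    obtain ⟨i, -, hi⟩ := hdd
    rw [hS d hd, hS d' hd', ← mul_sub, ← Finset.sum_sub_distrib,
      ← Finset.add_sum_erase _ _ (Finset.mem_univ i), abs_mul, abs_of_pos (by positivity),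
      one_div_mul_eq_div]
    gcongr
    have hrest : |∑ j ∈ Finset.univ.erase i, (φ (A d) (d j) - φ (A d') (d' j))| ≤
        α * κ * ρ := by
      calc |∑ j ∈ Finset.univ.erase i, (φ (A d) (d j) - φ (A d') (d' j))|
          ≤ ∑ j ∈ Finset.univ.erase i, |φ (A d) (d j) - φ (A d') (d' j)| :=
            Finset.abs_sum_le_sum_abs _ _
        _ ≤ ∑ j ∈ Finset.univ.erase i, α * ρ * (κ / n) := Finset.sum_le_sum fun j hj => by
            rw [hi j (Finset.ne_of_mem_erase hj)]
            exact hsecond _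
        _ ≤ ∑ _j : Fin n, α * ρ * (κ / n) :=
            Finset.sum_le_sum_of_subset_of_nonneg (Finset.erase_subset _ _)
              fun _ _ _ => by positivity
        _ = α * κ * ρ := by
            simp only [Finset.sum_const, Finset.card_univ, Fintype.card_fin, nsmul_eq_mul]
            field_simp
    have h₁ := abs_le.1 (hfirst d hd (d i))
    have h₂ := abs_le.1 (hfirst d' hd' (d' i))
    have h₃ := abs_le.1 hrest
    rw [abs_le]
    constructor <;> linarith
  refine ⟨hbd, ?_⟩
  have h := subGaussian_pi_of_bounded_differences P
    (c := |(α * κ * ρ + 2 * g₀ * ρ + α * ρ ^ 2) / n|) n S hSmeas fun i d d' hdd => by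
      by_cases hi : d i = d' i
      · have : d = d' := funext fun j => by
          by_cases hj : j = i
          · rw [hj, hi]
          · exact hdd j hj
        simp [this]
      · exact (hbd d d' ⟨i, hi, hdd⟩).trans (le_abs_self _)
  convert h using 1
  rw [sq_abs, mul_pow, div_pow, div_pow, Real.sq_sqrt hn'.le]
  field_simp
  ring
end

section
/- Let N ≥ 1, ν > 0, m₀ ∈ ℝ^N, and let μ be a probability measure on ℝ^N with ∫‖m − m₀‖² dμ(m) < ∞. Let Q = ∫ N(m, ν² I_N) dμ(m) be the Gaussian mixture obtained by drawing a mean m ∼ μ and then sampling from the Gaussian with mean m and covariance ν² I_N, and let P = N(m₀, ν² I_N). Then KL(Q‖P) ≤ (1/(2ν²)) ∫ ‖m − m₀‖² dμ(m). -/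
open MeasureTheory Real

/-- Kullback–Leibler divergence `KL(Q‖P) = ∫ log (dQ/dP) dQ`. -/
noncomputable def klDiv {Ω : Type*} [MeasurableSpace Ω] (Q P : Measure Ω) : ℝ :=
  ∫ x, Real.log ((Q.rnDeriv P x).toReal) ∂Q

/-- The multivariate Gaussian measure on `ℝ^N` with mean `m` and covariance
`ν² I_N`, given by its density with respect to Lebesgue measure. -/
noncomputable def gaussianIso (N : ℕ) (m : EuclideanSpace ℝ (Fin N)) (ν : ℝ) :
    Measure (EuclideanSpace ℝ (Fin N)) :=
  volume.withDensity fun x =>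
    ENNReal.ofReal ((2 * π * ν ^ 2) ^ (-(N : ℝ) / 2) *
      Real.exp (-‖x - m‖ ^ 2 / (2 * ν ^ 2)))

lemma integrable_exp_neg_mul_norm_sq {V : Type*} [NormedAddCommGroup V] [InnerProductSpace ℝ V]
    [FiniteDimensional ℝ V] [MeasurableSpace V] [BorelSpace V] {b : ℝ} (hb : 0 < b) :
    Integrable fun v : V => Real.exp (-b * ‖v‖ ^ 2) := by
  refine Integrable.of_integral_ne_zero ?_
  rw [GaussianFourier.integral_rexp_neg_mul_sq_norm hb]
  positivity

lemma measurable_gaussianIso_density (N : ℕ) (m : EuclideanSpace ℝ (Fin N)) (ν : ℝ) :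
    Measurable fun x : EuclideanSpace ℝ (Fin N) =>
      ENNReal.ofReal ((2 * π * ν ^ 2) ^ (-(N : ℝ) / 2) *
        Real.exp (-‖x - m‖ ^ 2 / (2 * ν ^ 2))) := by
  fun_prop

lemma lintegral_gaussianIso (N : ℕ) (m : EuclideanSpace ℝ (Fin N)) (ν : ℝ)
    {f : EuclideanSpace ℝ (Fin N) → ENNReal} (hf : Measurable f) :
    ∫⁻ x, f x ∂gaussianIso N m ν =
      ∫⁻ x, ENNReal.ofReal ((2 * π * ν ^ 2) ^ (-(N : ℝ) / 2) *
        Real.exp (-‖x - m‖ ^ 2 / (2 * ν ^ 2))) * f x := by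
  rw [gaussianIso, lintegral_withDensity_eq_lintegral_mul _
    (measurable_gaussianIso_density N m ν) hf]
  rfl

lemma gaussianIso_eq_map_add (N : ℕ) (m : EuclideanSpace ℝ (Fin N)) (ν : ℝ) :
    gaussianIso N m ν = (gaussianIso N 0 ν).map (m + ·) := by
  refine Measure.ext_of_lintegral _ fun f hf => ?_
  rw [lintegral_map hf (by fun_prop), lintegral_gaussianIso N m ν hf,
    lintegral_gaussianIso N 0 ν (by fun_prop), ← lintegral_add_left_eq_self _ m]
  simp

lemma isProbabilityMeasure_gaussianIso (N : ℕ) (m : EuclideanSpace ℝ (Fin N)) {ν : ℝ}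
    (hν : 0 < ν) : IsProbabilityMeasure (gaussianIso N m ν) := by
  have h0 : IsProbabilityMeasure (gaussianIso N 0 ν) := by
    constructor
    have hb : 0 < 1 / (2 * ν ^ 2) := by positivity
    have he (x : EuclideanSpace ℝ (Fin N)) :
        -‖x - 0‖ ^ 2 / (2 * ν ^ 2) = -(1 / (2 * ν ^ 2)) * ‖x‖ ^ 2 := by
      rw [sub_zero]; ring
    rw [gaussianIso, withDensity_apply _ MeasurableSet.univ, Measure.restrict_univ]
    simp only [he]
    rw [← ofReal_integral_eq_lintegral_ofReal
      ((integrable_exp_neg_mul_norm_sq hb).const_mul _) (.of_forall fun _ => by positivity),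
      integral_const_mul, GaussianFourier.integral_rexp_neg_mul_sq_norm hb,
      finrank_euclideanSpace_fin, show π / (1 / (2 * ν ^ 2)) = 2 * π * ν ^ 2 by field_simp,
      ← Real.rpow_add (by positivity)]
    simp [neg_div]
  rw [gaussianIso_eq_map_add]
  exact Measure.isProbabilityMeasure_map (by fun_prop)

lemma integrable_norm_gaussianIso (N : ℕ) {ν : ℝ} (hν : 0 < ν) :
    Integrable (fun z => ‖z‖) (gaussianIso N 0 ν) := by
  rw [gaussianIso, integrable_withDensity_iff (measurable_gaussianIso_density N 0 ν)
    (.of_forall fun _ => ENNReal.ofReal_lt_top)]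
  have hb : 0 < 1 / (4 * ν ^ 2) := by positivity
  refine ((integrable_exp_neg_mul_norm_sq hb).const_mul
    (ν * (2 * π * ν ^ 2) ^ (-(N : ℝ) / 2))).mono' (by fun_prop) (.of_forall fun z => ?_)
  have hz : ‖z‖ ≤ ν * Real.exp (1 / (4 * ν ^ 2) * ‖z‖ ^ 2) := by
    have h1 := Real.add_one_le_exp (1 / (4 * ν ^ 2) * ‖z‖ ^ 2)
    have h2 : ν * (1 / (4 * ν ^ 2) * ‖z‖ ^ 2 + 1) - ‖z‖ = ν * (1 - ‖z‖ / (2 * ν)) ^ 2 := by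
      field_simp; ring
    have h3 : 0 ≤ ν * (1 - ‖z‖ / (2 * ν)) ^ 2 := by positivity
    nlinarith
  rw [ENNReal.toReal_ofReal (by positivity), Real.norm_of_nonneg (by positivity), sub_zero]
  calc ‖z‖ * ((2 * π * ν ^ 2) ^ (-(N : ℝ) / 2) * Real.exp (-‖z‖ ^ 2 / (2 * ν ^ 2)))
      ≤ ν * Real.exp (1 / (4 * ν ^ 2) * ‖z‖ ^ 2) *
        ((2 * π * ν ^ 2) ^ (-(N : ℝ) / 2) * Real.exp (-‖z‖ ^ 2 / (2 * ν ^ 2))) := by gcongr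
    _ = ν * (2 * π * ν ^ 2) ^ (-(N : ℝ) / 2) * (Real.exp (1 / (4 * ν ^ 2) * ‖z‖ ^ 2) *
        Real.exp (-‖z‖ ^ 2 / (2 * ν ^ 2))) := by ring
    _ = ν * (2 * π * ν ^ 2) ^ (-(N : ℝ) / 2) * Real.exp (-(1 / (4 * ν ^ 2)) * ‖z‖ ^ 2) := by
      rw [← Real.exp_add]
      congr 2
      field_simp
      ring

lemma integral_inner_gaussianIso (N : ℕ) (ν : ℝ) (w : EuclideanSpace ℝ (Fin N)) :
    ∫ z, inner ℝ w z ∂gaussianIso N 0 ν = 0 := by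
  rw [gaussianIso, integral_withDensity_eq_integral_toReal_smul
    (measurable_gaussianIso_density N 0 ν) (.of_forall fun _ => ENNReal.ofReal_lt_top)]
  have h := integral_neg_eq_self (fun z : EuclideanSpace ℝ (Fin N) =>
    (ENNReal.ofReal ((2 * π * ν ^ 2) ^ (-(N : ℝ) / 2) *
      Real.exp (-‖z - 0‖ ^ 2 / (2 * ν ^ 2)))).toReal • inner ℝ w z) volume
  simp only [sub_zero, norm_neg, inner_neg_right, smul_neg, integral_neg] at h ⊢
  linarith

lemma bind_gaussianIso (N : ℕ) (ν : ℝ) [SFinite (gaussianIso N 0 ν)]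
    (μ : Measure (EuclideanSpace ℝ (Fin N))) :
    μ.bind (fun m => gaussianIso N m ν) =
      (μ.prod (gaussianIso N 0 ν)).map (fun p => p.1 + p.2) := by
  have happly (m : EuclideanSpace ℝ (Fin N)) {s : Set (EuclideanSpace ℝ (Fin N))}
      (hs : MeasurableSet s) : gaussianIso N m ν s =
        gaussianIso N 0 ν (Prod.mk m ⁻¹' ((fun p => p.1 + p.2) ⁻¹' s)) := by
    rw [gaussianIso_eq_map_add, Measure.map_apply (by fun_prop) hs]
    rfl
  have hpre {s : Set (EuclideanSpace ℝ (Fin N))} (hs : MeasurableSet s) :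
      MeasurableSet ((fun p : EuclideanSpace ℝ (Fin N) × EuclideanSpace ℝ (Fin N) =>
        p.1 + p.2) ⁻¹' s) :=
    measurable_fst.add measurable_snd hs
  have hmeas : Measurable fun m => gaussianIso N m ν :=
    Measure.measurable_of_measurable_coe _ fun s hs => by
      simp only [happly _ hs]
      exact measurable_measure_prodMk_left (hpre hs)
  ext s hs
  rw [Measure.bind_apply hs hmeas.aemeasurable, Measure.map_apply (by fun_prop) hs,
    Measure.prod_apply (hpre hs)]
  simp only [happly _ hs]

/-- Data-processing inequality for the real-valued divergence, with the divergence on the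
larger space given by an exponential density. -/
lemma klDiv_map_le_integral {Ω Ω' : Type*} [MeasurableSpace Ω] [MeasurableSpace Ω']
    (J : Measure Ω) [IsProbabilityMeasure J] {t : Ω → ℝ} (ht : Measurable t)
    (hint : Integrable t J) {g : Ω → Ω'} (hg : Measurable g)
    (P : Measure Ω') [IsProbabilityMeasure P]
    (hP : (J.withDensity fun x => ENNReal.ofReal (Real.exp (-t x))).map g = P) :
    klDiv (J.map g) P ≤ ∫ x, t x ∂J := by
  set R := J.withDensity fun x => ENNReal.ofReal (Real.exp (-t x))
  have hρ : Measurable fun x => ENNReal.ofReal (Real.exp (-t x)) := by fun_prop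
  have hRprob : IsProbabilityMeasure R := by
    constructor
    rw [← Set.preimage_univ (f := g), ← Measure.map_apply hg MeasurableSet.univ, hP,
      measure_univ]
  have hJ : R.withDensity (fun x => ENNReal.ofReal (Real.exp (-t x)))⁻¹ = J :=
    withDensity_inv_same hρ
      (.of_forall fun x => by simp [Real.exp_pos]) (.of_forall fun _ => ENNReal.ofReal_ne_top)
  have hac : J ≪ R := hJ ▸ withDensity_absolutelyContinuous _ _
  have hd : J.rnDeriv R =ᵐ[R] (fun x => ENNReal.ofReal (Real.exp (-t x)))⁻¹ := by
    have := Measure.rnDeriv_withDensity R hρ.inv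
    rwa [hJ] at this
  have hllr : llr J R =ᵐ[J] t := by
    filter_upwards [hac.ae_le hd] with x hx
    simp only [llr, hx, Pi.inv_apply, ENNReal.toReal_inv,
      ENNReal.toReal_ofReal (Real.exp_pos _).le, Real.log_inv, Real.log_exp, neg_neg]
  have hJg : IsProbabilityMeasure (J.map g) := Measure.isProbabilityMeasure_map hg.aemeasurable
  have hle := InformationTheory.klDiv_map_le J R hg
  rw [hP] at hle
  calc klDiv (J.map g) P = (InformationTheory.klDiv (J.map g) P).toReal :=
        (InformationTheory.toReal_klDiv_of_measure_eq (hP ▸ hac.map hg) (by simp)).symm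
    _ ≤ (InformationTheory.klDiv J R).toReal :=
        ENNReal.toReal_mono
          (InformationTheory.klDiv_ne_top hac (hint.congr hllr.symm)) hle
    _ = ∫ x, llr J R x ∂J := InformationTheory.toReal_klDiv_of_measure_eq hac (by simp)
    _ = ∫ x, t x ∂J := integral_congr_ae hllr

/-- dataset-shift bound: for a Gaussian mixture
`Q = ∫ N(m, ν²I) dμ(m)` and `P = N(m₀, ν²I)`,
`KL(Q‖P) ≤ (1/(2ν²)) ∫ ‖m − m₀‖² dμ(m)`. -/
theorem stmt_13 (N : ℕ) (hN : 1 ≤ N) (ν : ℝ) (hν : 0 < ν)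
    (m₀ : EuclideanSpace ℝ (Fin N))
    (μ : Measure (EuclideanSpace ℝ (Fin N))) [IsProbabilityMeasure μ]
    (hint : Integrable (fun m => ‖m - m₀‖ ^ 2) μ)
    (Q : Measure (EuclideanSpace ℝ (Fin N)))
    (hQ : Q = μ.bind fun m => gaussianIso N m ν) :
    klDiv Q (gaussianIso N m₀ ν) ≤ (1 / (2 * ν ^ 2)) * ∫ m, ‖m - m₀‖ ^ 2 ∂μ := by
  have hγ := isProbabilityMeasure_gaussianIso N 0 hν
  have hP := isProbabilityMeasure_gaussianIso N m₀ hν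
  let t : EuclideanSpace ℝ (Fin N) × EuclideanSpace ℝ (Fin N) → ℝ :=
    fun p => (‖p.1 + p.2 - m₀‖ ^ 2 - ‖p.2‖ ^ 2) / (2 * ν ^ 2)
  have ht : Measurable t := by fun_prop
  have ht_eq : t = fun p => 1 / ν ^ 2 * inner ℝ (p.1 - m₀) p.2 +
      1 / (2 * ν ^ 2) * ‖p.1 - m₀‖ ^ 2 := by
    funext p
    simp only [t]
    rw [show p.1 + p.2 - m₀ = (p.1 - m₀) + p.2 by abel, norm_add_sq_real]
    field_simp
    ring
  have hnorm : Integrable (fun m => ‖m - m₀‖) μ :=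
    (hint.add (integrable_const 1)).mono' (by fun_prop) (.of_forall fun m => by
      simp only [norm_norm, Pi.add_apply]
      nlinarith [sq_nonneg (‖m - m₀‖ - 1), sq_nonneg ‖m - m₀‖])
  have hinner : Integrable (fun p => inner ℝ (p.1 - m₀) p.2) (μ.prod (gaussianIso N 0 ν)) :=
    (hnorm.mul_prod (integrable_norm_gaussianIso N hν)).mono' (by fun_prop)
      (.of_forall fun p => norm_inner_le_norm _ _)
  have hsq : Integrable (fun p => ‖p.1 - m₀‖ ^ 2) (μ.prod (gaussianIso N 0 ν)) :=
    hint.comp_fst _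
  have htint : Integrable t (μ.prod (gaussianIso N 0 ν)) :=
    ht_eq ▸ (hinner.const_mul _).add (hsq.const_mul _)
  have hmap : ((μ.prod (gaussianIso N 0 ν)).withDensity
      fun p => ENNReal.ofReal (Real.exp (-t p))).map (fun p => p.1 + p.2) =
        gaussianIso N m₀ ν := by
    refine Measure.ext_of_lintegral _ fun f hf => ?_
    have hρ : Measurable fun p => ENNReal.ofReal (Real.exp (-t p)) := by fun_prop
    have hF : Measurable fun p : EuclideanSpace ℝ (Fin N) × EuclideanSpace ℝ (Fin N) =>
        ENNReal.ofReal (Real.exp (-t p)) * f (p.1 + p.2) := by fun_prop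
    have hslice (m : EuclideanSpace ℝ (Fin N)) :
        ∫⁻ z, ENNReal.ofReal (Real.exp (-t (m, z))) * f (m + z) ∂gaussianIso N 0 ν =
          ∫⁻ x, f x ∂gaussianIso N m₀ ν := by
      refine (lintegral_gaussianIso N 0 ν (hF.comp measurable_prodMk_left)).trans ?_
      conv_rhs => rw [lintegral_gaussianIso N m₀ ν hf, ← lintegral_add_left_eq_self _ m]
      refine lintegral_congr fun z => ?_
      simp only [Function.comp_apply]
      rw [← mul_assoc, ← ENNReal.ofReal_mul (by positivity), mul_assoc, ← Real.exp_add]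
      congr 4
      simp only [t, sub_zero]
      ring
    rw [lintegral_map hf (by fun_prop), lintegral_withDensity_eq_lintegral_mul _ hρ
      (by fun_prop)]
    simp only [Pi.mul_apply]
    rw [lintegral_prod _ hF.aemeasurable]
    simp only [hslice, lintegral_const, measure_univ, mul_one]
  rw [hQ, bind_gaussianIso]
  refine (klDiv_map_le_integral _ ht htint (by fun_prop) _ hmap).trans_eq ?_
  rw [ht_eq, integral_add (hinner.const_mul _) (hsq.const_mul _), integral_const_mul,
    integral_const_mul, integral_prod _ hinner, integral_fun_fst (fun m => ‖m - m₀‖ ^ 2)]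
  simp [integral_inner_gaussianIso]
end
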